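/- arXiv:2405.20300 — 10 statements merged into one kernel-verified Lean document; each statement's English description precedes it below -/
import Mathlib

section
/- Let L be a symmetric positive semidefinite real n×n matrix whose kernel is exactly the span of the all-ones vector 1, and let L† denote its Moore–Penrose pseudoinverse. Then there exists an (n−1)×n real matrix V with L† = VᵀV, V·1 = 0, and such that the n columns of V are affinely independent points of ℝ^{n−1}. -/
open Matrix Finset

namespace Matrix

/-- If `X` satisfies the Penrose conditions for a symmetric matrix `A`, then `X` is symmetric. -/
theorem IsSymm.of_penrose {n R : Type*} [Fintype n] [CommRing R] {A X : Matrix n n R}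
    (hA : A.IsSymm) (h1 : A * X * A = A) (h2 : X * A * X = X)
    (h3 : (A * X)ᵀ = A * X) (h4 : (X * A)ᵀ = X * A) : X.IsSymm := by
  have hA' : Aᵀ = A := hA
  rw [transpose_mul, hA'] at h3 h4
  have h1' : A * Xᵀ * A = A := by
    simpa [transpose_mul, hA', Matrix.mul_assoc] using congrArg Matrix.transpose h1
  have h2' : Xᵀ * A * Xᵀ = Xᵀ := by
    simpa [transpose_mul, hA', Matrix.mul_assoc] using congrArg Matrix.transpose h2
  have hcomm : A * X = X * A := by
    calc A * X = A * Xᵀ * A * X := by rw [h1']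
      _ = X * A * (Xᵀ * A) := by rw [h4, h3, Matrix.mul_assoc]
      _ = X * (A * Xᵀ * A) := by simp only [Matrix.mul_assoc]
      _ = X * A := by rw [h1']
  calc Xᵀ = Xᵀ * A * Xᵀ := h2'.symm
    _ = X * A * Xᵀ := by rw [h3, hcomm]
    _ = X * A * X := by rw [Matrix.mul_assoc, Matrix.mul_assoc, h4, hcomm]
    _ = X := h2

open scoped MatrixOrder in
/-- A positive semidefinite real matrix of size `m + 1` whose rows sum to zero is the Gram matrix
of `m + 1` points of `ℝ^m` that sum to zero. -/
theorem PosSemidef.exists_transpose_mul_self_of_mulVec_one {m : ℕ}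
    {A : Matrix (Fin (m + 1)) (Fin (m + 1)) ℝ} (hA : A.PosSemidef)
    (h : A *ᵥ (fun _ => 1) = 0) :
    ∃ V : Matrix (Fin m) (Fin (m + 1)) ℝ, Vᵀ * V = A ∧ V *ᵥ (fun _ => 1) = 0 := by
  obtain ⟨C, hC⟩ := CStarAlgebra.nonneg_iff_eq_star_mul_self.mp (hA.submatrix Fin.succ).nonneg
  rw [star_eq_conjTranspose, conjTranspose_eq_transpose_of_trivial] at hC
  have hsymm (i j) : A i j = A j i := by simpa using (hA.isHermitian.apply i j).symm
  have hrow (i) : A i 0 = -∑ j : Fin m, A i j.succ := by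
    have := congrFun h i
    simp only [mulVec, dotProduct, mul_one, Fin.sum_univ_succ, Pi.zero_apply] at this
    linarith
  have hgram (i j : Fin m) : ∑ k, C k i * C k j = A i.succ j.succ := by
    simpa [mul_apply] using (congrFun (congrFun hC i) j).symm
  refine ⟨of fun k => Fin.cons (-∑ j, C k j) (C k), ?_, ?_⟩
  · have hzero (i : Fin m) : ∑ k, C k i * ∑ j, C k j = ∑ j : Fin m, A i.succ j.succ := by
      simp_rw [Finset.mul_sum, ← hgram]
      exact Finset.sum_comm
    ext i j
    refine Fin.cases ?_ (fun i => ?_) i <;> refine Fin.cases ?_ (fun j => ?_) j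
    · have : A 0 0 = ∑ i : Fin m, ∑ j : Fin m, A i.succ j.succ := by
        rw [hrow, ← Finset.sum_neg_distrib]
        refine Finset.sum_congr rfl fun i _ => ?_
        rw [hsymm, hrow, neg_neg]
      simp only [mul_apply, transpose_apply, of_apply, Fin.cons_zero, neg_mul_neg, this, ← hzero]
      simp_rw [Finset.sum_mul]
      exact Finset.sum_comm
    · rw [hsymm, hrow, ← hzero]
      simp [mul_apply, mul_comm]
    · rw [hrow, ← hzero]
      simp [mul_apply]
    · simpa [mul_apply] using hgram i j
  · ext k
    simp [mulVec, dotProduct, Fin.sum_univ_succ]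

end Matrix

/-- Lemma 3.1 (second part): the Moore–Penrose pseudoinverse `Ld` of a symmetric
positive semidefinite matrix `L` with kernel exactly the span of the all-ones vector
factors as `Ld = Vᵀ * V` where `V * 1 = 0` and the columns of `V` are affinely
independent points of `ℝ^{n-1}`. -/
theorem pseudoinverse_factorization (n : ℕ) (hn : 2 ≤ n)
    (L Ld : Matrix (Fin n) (Fin n) ℝ)
    (hsym : L.IsSymm)
    (hpsd : L.PosSemidef)
    (hker : ∀ f : Fin n → ℝ, L.mulVec f = 0 ↔ ∃ c : ℝ, ∀ i, f i = c)
    -- the four Penrose conditions characterizing the Moore–Penrose pseudoinverse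
    (hp1 : L * Ld * L = L) (hp2 : Ld * L * Ld = Ld)
    (hp3 : (L * Ld)ᵀ = L * Ld) (hp4 : (Ld * L)ᵀ = Ld * L) :
    ∃ V : Matrix (Fin (n-1)) (Fin n) ℝ,
      Vᵀ * V = Ld ∧
      V.mulVec (fun _ => 1) = 0 ∧
      AffineIndependent ℝ (fun x : Fin n => (fun j => V j x : Fin (n-1) → ℝ)) := by
  obtain ⟨m, rfl⟩ : ∃ m, n = m + 1 := ⟨n - 1, by omega⟩
  have hLd : Ldᵀ = Ld := hsym.of_penrose hp1 hp2 hp3 hp4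
  have hcomm : Ld * L = L * Ld := by rw [← hp3, transpose_mul, hLd, hsym.eq]
  have hLd_psd : Ld.PosSemidef := by
    have := hpsd.conjTranspose_mul_mul_same Ld
    rwa [conjTranspose_eq_transpose_of_trivial, hLd, hp2] at this
  have hLd_one : Ld *ᵥ (fun _ => 1) = 0 := by
    rw [← hp2, Matrix.mul_assoc, ← hcomm, ← mulVec_mulVec, ← mulVec_mulVec,
      (hker _).mpr ⟨1, fun _ => rfl⟩, mulVec_zero, mulVec_zero]
  obtain ⟨V, hV, hV_one⟩ := hLd_psd.exists_transpose_mul_self_of_mulVec_one hLd_one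
  refine ⟨V, hV, hV_one, ?_⟩
  rw [affineIndependent_iff_of_fintype]
  intro w hw hwV
  rw [Finset.weightedVSub_eq_linear_combination _ hw] at hwV
  have hVw : V *ᵥ w = 0 := by
    ext j
    simpa [mulVec, dotProduct, mul_comm] using congrFun hwV j
  have hLw : L *ᵥ w = 0 := by
    rw [← hp1, Matrix.mul_assoc, hcomm, ← hV, ← mulVec_mulVec, ← mulVec_mulVec,
      ← mulVec_mulVec, hVw, mulVec_zero, mulVec_zero, mulVec_zero]
  obtain ⟨c, hc⟩ := (hker w).mp hLw
  have hc0 : c = 0 := by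
    simp only [hc, Finset.sum_const, Finset.card_univ, Fintype.card_fin, nsmul_eq_mul,
      mul_eq_zero, Nat.cast_eq_zero, Nat.succ_ne_zero, false_or] at hw
    exact hw
  intro i
  rw [hc, hc0]
end

section
/- Consider a reversible chain setup with transition matrix P, stationary vector π and Laplacian L, and let L† be the Moore–Penrose pseudoinverse of L. Fix two states x and y, and let h_x, h_y ∈ ℝ^n satisfy h_x(x) = 0, h_x(t) = 1 + Σ_z P(t,z)·h_x(z) for all t ≠ x, and h_y(y) = 0, h_y(t) = 1 + Σ_z P(t,z)·h_y(z) for all t ≠ y. Then h_x(y) + h_y(x) = (δ_y − δ_x)ᵀ·L†·(δ_y − δ_x), where δ_x, δ_y are standard basis vectors of ℝ^n. -/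
open Matrix Finset

/-- A vector of hitting times to `a` is mapped by the Laplacian to `w - δ_a`. -/
theorem laplacian_mulVec_hitting {ι : Type*} [Fintype ι] [DecidableEq ι]
    (P L : Matrix ι ι ℝ) (w : ι → ℝ)
    (hrow : ∀ t, ∑ z, P t z = 1) (hsum : ∑ t, w t = 1)
    (hrev : ∀ t z, w t * P t z = w z * P z t)
    (hL : ∀ t z, L t z = w t * ((if t = z then 1 else 0) - P t z))
    (a : ι) (h : ι → ℝ) (hrec : ∀ t, t ≠ a → h t = 1 + ∑ z, P t z * h z) :
    L *ᵥ h = w - Pi.single a 1 := by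
  have hmul (t : ι) : (L *ᵥ h) t = w t * (h t - ∑ z, P t z * h z) := by
    simp only [mulVec, dotProduct, hL, mul_assoc, sub_mul, ite_mul, one_mul, zero_mul]
    rw [← Finset.mul_sum, Finset.sum_sub_distrib, Finset.sum_ite_eq, if_pos (Finset.mem_univ t)]
  have hne (t : ι) (ht : t ≠ a) : (L *ᵥ h) t = w t := by
    rw [hmul, hrec t ht]
    ring
  have hzero : ∑ t, (L *ᵥ h) t = 0 := by
    simp only [hmul, mul_sub, Finset.sum_sub_distrib, Finset.mul_sum]
    rw [Finset.sum_comm, sub_eq_zero]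
    refine Finset.sum_congr rfl fun z _ => ?_
    have hz (t : ι) : w t * (P t z * h z) = w z * h z * P z t := by
      rw [← mul_assoc, hrev]
      ring
    simp only [hz, ← Finset.mul_sum, hrow, mul_one]
  ext t
  by_cases ht : t = a
  · subst ht
    rw [← Finset.add_sum_erase _ _ (Finset.mem_univ t),
      Finset.sum_congr rfl fun s hs => hne s (Finset.ne_of_mem_erase hs)] at hzero
    rw [← Finset.add_sum_erase _ _ (Finset.mem_univ t)] at hsum
    simp only [Pi.sub_apply, Pi.single_eq_same]
    linarith
  · simp [hne t ht, ht]

/-- The quadratic form of a generalized inverse of a symmetric matrix `L`, evaluated at `L *ᵥ g`. -/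
theorem dotProduct_generalizedInverse_mulVec {ι : Type*} [Fintype ι]
    (L G : Matrix ι ι ℝ) (hsymm : Lᵀ = L) (hG : L * G * L = L) (g : ι → ℝ) :
    (L *ᵥ g) ⬝ᵥ G *ᵥ (L *ᵥ g) = g ⬝ᵥ L *ᵥ g := by
  have hleft : L *ᵥ g = g ᵥ* L := by rw [← mulVec_transpose, hsymm]
  conv_lhs => rw [hleft, ← dotProduct_mulVec, ← hleft, mulVec_mulVec, mulVec_mulVec, hG]

/-- Equation (9): the commute time between `x` and `y` equals the effective resistance
`(δ_y − δ_x)ᵀ L† (δ_y − δ_x)`. -/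
theorem commute_time_effective_resistance (n : ℕ) (hn : 2 ≤ n)
    (P L Ld : Matrix (Fin n) (Fin n) ℝ) (pi : Fin n → ℝ)
    -- reversible chain setup
    (hP0 : ∀ x y, 0 ≤ P x y)
    (hPdiag : ∀ x, P x x = 0)
    (hProw : ∀ x, ∑ y, P x y = 1)
    (hpipos : ∀ x, 0 < pi x)
    (hpisum : ∑ x, pi x = 1)
    (hrev : ∀ x y, pi x * P x y = pi y * P y x)
    (hconn : (SimpleGraph.fromRel (fun x y : Fin n => 0 < P x y)).Connected)
    -- the Laplacian matrix
    (hLdiag : ∀ x, L x x = pi x)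
    (hLoff : ∀ x y, x ≠ y → L x y = -(pi x * P x y))
    -- Ld is the Moore–Penrose pseudoinverse of L (the four Penrose conditions)
    (hp1 : L * Ld * L = L) (hp2 : Ld * L * Ld = Ld)
    (hp3 : (L * Ld)ᵀ = L * Ld) (hp4 : (Ld * L)ᵀ = Ld * L)
    -- hitting times to x and to y
    (x y : Fin n) (hx hy : Fin n → ℝ)
    (hhx : hx x = 0)
    (hrecx : ∀ t, t ≠ x → hx t = 1 + ∑ z, P t z * hx z)
    (hhy : hy y = 0)
    (hrecy : ∀ t, t ≠ y → hy t = 1 + ∑ z, P t z * hy z) :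
    hx y + hy x =
      (Pi.single y 1 - Pi.single x 1) ⬝ᵥ Ld.mulVec (Pi.single y 1 - Pi.single x 1) := by
  have hL (s t : Fin n) : L s t = pi s * ((if s = t then 1 else 0) - P s t) := by
    by_cases h : s = t
    · subst h
      simp [hLdiag, hPdiag]
    · simp [hLoff s t h, h]
  have hsymm : Lᵀ = L := by
    ext s t
    by_cases h : s = t
    · rw [transpose_apply, h]
    · rw [transpose_apply, hLoff s t h, hLoff t s (Ne.symm h), hrev]
  have hg : L *ᵥ (hx - hy) = Pi.single y 1 - Pi.single x 1 := by
    rw [mulVec_sub, laplacian_mulVec_hitting P L pi hProw hpisum hrev hL x hx hrecx,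
      laplacian_mulVec_hitting P L pi hProw hpisum hrev hL y hy hrecy, sub_sub_sub_cancel_left]
  rw [← hg, dotProduct_generalizedInverse_mulVec L Ld hsymm hp1, hg, dotProduct_sub,
    dotProduct_single_one, dotProduct_single_one]
  simp only [Pi.sub_apply, hhx, hhy]
  ring
end

section
/- Consider a reversible chain setup with transition matrix P, stationary vector π and Laplacian L, with Moore–Penrose pseudoinverse L†, and let V be an (n−1)×n real matrix with VᵀV = L† and V·1 = 0, with columns v_1,…,v_n ∈ ℝ^{n−1}. Fix two states x and y, and let h_x, h_y ∈ ℝ^n satisfy h_x(x) = 0, h_x(t) = 1 + Σ_z P(t,z)·h_x(z) for all t ≠ x, and h_y(y) = 0, h_y(t) = 1 + Σ_z P(t,z)·h_y(z) for all t ≠ y. Then the squared Euclidean distance between the corresponding vertices equals the commute time: ‖v_x − v_y‖² = h_x(y) + h_y(x). -/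
open Matrix Finset

section Laplacian

variable {ι : Type*} {P L : Matrix ι ι ℝ} {μ : ι → ℝ}

lemma laplacian_transpose (hrev : ∀ x y, μ x * P x y = μ y * P y x)
    (hLoff : ∀ x y, x ≠ y → L x y = -(μ x * P x y)) : Lᵀ = L := by
  ext a b
  rcases eq_or_ne a b with rfl | h
  · rfl
  · rw [transpose_apply, hLoff a b h, hLoff b a h.symm, hrev]

variable [Fintype ι] [DecidableEq ι]

/-- The Laplacian of a chain acts as `diag μ * (1 - P)`. -/
lemma laplacian_mulVec_apply (hPdiag : ∀ x, P x x = 0) (hLdiag : ∀ x, L x x = μ x)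
    (hLoff : ∀ x y, x ≠ y → L x y = -(μ x * P x y)) (u : ι → ℝ) (t : ι) :
    (L *ᵥ u) t = μ t * (u t - ∑ z, P t z * u z) := by
  have hL : ∀ z, L t z * u z = (if t = z then μ t * u z else 0) - μ t * (P t z * u z) := by
    intro z
    split_ifs with h
    · subst h
      rw [hLdiag, hPdiag]
      ring
    · rw [hLoff t z h]
      ring
  simp only [mulVec, dotProduct, hL, sum_sub_distrib, ← mul_sum, sum_ite_eq, mem_univ, if_true]
  ring

/-- Hitting times solve a Poisson equation for the Laplacian. -/
lemma laplacian_mulVec_hittingTime (hPdiag : ∀ x, P x x = 0) (hProw : ∀ x, ∑ y, P x y = 1)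
    (hμ : ∑ x, μ x = 1) (hrev : ∀ x y, μ x * P x y = μ y * P y x)
    (hLdiag : ∀ x, L x x = μ x) (hLoff : ∀ x y, x ≠ y → L x y = -(μ x * P x y))
    {x : ι} {h : ι → ℝ} (hrec : ∀ t, t ≠ x → h t = 1 + ∑ z, P t z * h z) :
    L *ᵥ h = μ - Pi.single x 1 := by
  have hne : ∀ t, t ≠ x → (L *ᵥ h) t = μ t := by
    intro t ht
    rw [laplacian_mulVec_apply hPdiag hLdiag hLoff, sub_eq_of_eq_add (hrec t ht), mul_one]
  have hone : L *ᵥ 1 = 0 := by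
    ext t
    simp [laplacian_mulVec_apply hPdiag hLdiag hLoff, hProw]
  have hsum : ∑ t, (L *ᵥ h) t = 0 := by
    rw [← one_dotProduct, dotProduct_mulVec, ← mulVec_transpose,
      laplacian_transpose hrev hLoff, hone, zero_dotProduct]
  ext t
  rcases eq_or_ne t x with rfl | ht
  · rw [← add_sum_erase _ _ (mem_univ t)] at hsum hμ
    rw [sum_congr rfl fun s hs => hne s (ne_of_mem_erase hs)] at hsum
    simp only [Pi.sub_apply, Pi.single_eq_same]
    linarith
  · simp [hne t ht, ht]

end Laplacian

/-- Theorem 3.1: the squared edge lengths of the simplex associated with a reversible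
Markov chain are the commute times: `‖v_x − v_y‖² = h_x(y) + h_y(x)`. -/
theorem simplex_edge_lengths_are_commute_times (n : ℕ) (hn : 2 ≤ n)
    (P L Ld : Matrix (Fin n) (Fin n) ℝ) (pi : Fin n → ℝ)
    -- reversible chain setup
    (hP0 : ∀ x y, 0 ≤ P x y)
    (hPdiag : ∀ x, P x x = 0)
    (hProw : ∀ x, ∑ y, P x y = 1)
    (hpipos : ∀ x, 0 < pi x)
    (hpisum : ∑ x, pi x = 1)
    (hrev : ∀ x y, pi x * P x y = pi y * P y x)
    (hconn : (SimpleGraph.fromRel (fun x y : Fin n => 0 < P x y)).Connected)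
    -- the Laplacian matrix
    (hLdiag : ∀ x, L x x = pi x)
    (hLoff : ∀ x y, x ≠ y → L x y = -(pi x * P x y))
    -- Ld is the Moore–Penrose pseudoinverse of L (the four Penrose conditions)
    (hp1 : L * Ld * L = L) (hp2 : Ld * L * Ld = Ld)
    (hp3 : (L * Ld)ᵀ = L * Ld) (hp4 : (Ld * L)ᵀ = Ld * L)
    -- the matrix V with VᵀV = L† and V·1 = 0, whose columns are the simplex vertices
    (V : Matrix (Fin (n-1)) (Fin n) ℝ)
    (hV : Vᵀ * V = Ld)
    (hV1 : V.mulVec (fun _ => 1) = 0)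
    (v : Fin n → EuclideanSpace ℝ (Fin (n-1)))
    (hv : ∀ c j, v c j = V j c)
    -- hitting times to x and to y
    (x y : Fin n) (hx hy : Fin n → ℝ)
    (hhx : hx x = 0)
    (hrecx : ∀ t, t ≠ x → hx t = 1 + ∑ z, P t z * hx z)
    (hhy : hy y = 0)
    (hrecy : ∀ t, t ≠ y → hy t = 1 + ∑ z, P t z * hy z) :
    ‖v x - v y‖^2 = hx y + hy x := by
  set w := hy - hx
  set d : Fin n → ℝ := Pi.single x 1 - Pi.single y 1 with hd
  have hLw : L *ᵥ w = d := by
    rw [mulVec_sub, laplacian_mulVec_hittingTime hPdiag hProw hpisum hrev hLdiag hLoff hrecx,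
      laplacian_mulVec_hittingTime hPdiag hProw hpisum hrev hLdiag hLoff hrecy,
      sub_sub_sub_cancel_left]
  have hnorm : ‖v x - v y‖ ^ 2 = d ⬝ᵥ Ld *ᵥ d := by
    rw [← hV, ← mulVec_mulVec, dotProduct_mulVec, vecMul_transpose, EuclideanSpace.real_norm_sq_eq]
    refine sum_congr rfl fun j _ => ?_
    simp [hd, hv, mulVec_sub, sq]
  calc ‖v x - v y‖ ^ 2 = w ⬝ᵥ (L * Ld * L) *ᵥ w := by
        rw [hnorm, ← hLw, ← mulVec_mulVec, ← mulVec_mulVec, dotProduct_mulVec w L,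
          ← mulVec_transpose, laplacian_transpose hrev hLoff]
    _ = hx y + hy x := by
        rw [hp1, hLw]
        simp [hd, w, dotProduct_sub, hhx, hhy]
        ring
end

section
/- Consider a reversible chain setup with transition matrix P, stationary vector π and Laplacian L. For each state y, let h_y ∈ ℝ^n satisfy h_y(y) = 0 and h_y(t) = 1 + Σ_z P(t,z)·h_y(z) for all t ≠ y. Then the quantity K_x := Σ_y π(y)·h_y(x) is independent of the state x; that is, Σ_y π(y)·h_y(x) = Σ_y π(y)·h_y(x') for all states x, x'. -/
open Matrix Finset

/-- Maximum principle: a function harmonic for a stochastic matrix with symmetric support and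
connected support graph is constant. -/
theorem harmonic_eq_of_connected {α : Type*} [Fintype α] {P : Matrix α α ℝ} {f : α → ℝ}
    (hP0 : ∀ x y, 0 ≤ P x y) (hProw : ∀ x, ∑ y, P x y = 1)
    (hsymm : ∀ x y, 0 < P y x → 0 < P x y)
    (hconn : (SimpleGraph.fromRel (fun x y => 0 < P x y)).Connected)
    (hf : ∀ x, f x = ∑ y, P x y * f y) (x x' : α) : f x = f x' := by
  have : Nonempty α := ⟨x⟩
  obtain ⟨m, hm⟩ := Finite.exists_max f
  have step : ∀ a b, 0 < P a b → f a = f m → f b = f m := by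
    intro a b hab ha
    have hsum : ∑ y, P a y * (f m - f y) = 0 := by
      simp only [mul_sub, sum_sub_distrib, ← sum_mul, hProw, one_mul, ← hf, ha, sub_self]
    have hb := (sum_eq_zero_iff_of_nonneg
      fun y _ => mul_nonneg (hP0 a y) (sub_nonneg.2 (hm y))).1 hsum b (mem_univ b)
    linarith [(mul_eq_zero.1 hb).resolve_left hab.ne']
  have eq_max : ∀ a, f a = f m := by
    intro a
    obtain ⟨w⟩ := hconn.preconnected a m
    induction w with
    | nil => rfl
    | cons hadj _ ih =>
      rw [SimpleGraph.fromRel_adj] at hadj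
      exact step _ _ (hadj.2.elim (hsymm _ _) id) (ih hm step)
  rw [eq_max x, eq_max x']

/-- Summing the hitting-time recursion against `π` determines its defect at the target. -/
theorem hitting_time_defect {α : Type*} [Fintype α] {P : Matrix α α ℝ} {p g : α → ℝ}
    {y : α} (hpsum : ∑ x, p x = 1) (hstat : ∀ z, ∑ t, p t * P t z = p z)
    (hg : ∀ t, t ≠ y → g t = 1 + ∑ z, P t z * g z) :
    p y * (g y - ∑ z, P y z * g z) = p y - 1 := by
  have hzero : ∑ t, p t * (g t - ∑ z, P t z * g z) = 0 := by
    simp only [mul_sub, sum_sub_distrib, mul_sum, ← mul_assoc]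
    rw [sum_comm (f := fun t z => p t * P t z * g z)]
    simp only [← sum_mul, hstat, sub_self]
  have hone : ∑ t, p t * (g t - ∑ z, P t z * g z - 1) = -1 := by
    simp only [mul_sub _ _ (1 : ℝ), sum_sub_distrib, hzero, mul_one, hpsum, zero_sub]
  rw [Fintype.sum_eq_single y fun t ht => by rw [hg t ht]; ring] at hone
  linarith

/-- Theorem 2.1 (Kemeny's constant is a constant, reversible loop-free case):
`K_x = Σ_y π(y) h_y(x)` does not depend on the state `x`. -/
theorem kemeny_constant_is_constant (n : ℕ) (hn : 2 ≤ n)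
    (P L : Matrix (Fin n) (Fin n) ℝ) (pi : Fin n → ℝ)
    -- reversible chain setup
    (hP0 : ∀ x y, 0 ≤ P x y)
    (hPdiag : ∀ x, P x x = 0)
    (hProw : ∀ x, ∑ y, P x y = 1)
    (hpipos : ∀ x, 0 < pi x)
    (hpisum : ∑ x, pi x = 1)
    (hrev : ∀ x y, pi x * P x y = pi y * P y x)
    (hconn : (SimpleGraph.fromRel (fun x y : Fin n => 0 < P x y)).Connected)
    -- the Laplacian matrix
    (hLdiag : ∀ x, L x x = pi x)
    (hLoff : ∀ x y, x ≠ y → L x y = -(pi x * P x y))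
    -- hitting times to each state y
    (h : Fin n → Fin n → ℝ)
    (hdiag : ∀ y, h y y = 0)
    (hrec : ∀ y t, t ≠ y → h y t = 1 + ∑ z, P t z * h y z) :
    ∀ x x' : Fin n, ∑ y, pi y * h y x = ∑ y, pi y * h y x' := by
  have hstat : ∀ z, ∑ t, pi t * P t z = pi z := fun z => by
    simp only [hrev _ z, ← mul_sum, hProw, mul_one]
  refine harmonic_eq_of_connected hP0 hProw (fun x y hyx => ?_) hconn fun x => ?_
  · exact pos_of_mul_pos_right (hrev x y ▸ mul_pos (hpipos y) hyx) (hpipos x).le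
  · have hsum : ∑ y, pi y * (h y x - ∑ z, P x z * h y z - 1) = -1 := by
      rw [Fintype.sum_eq_single x fun y hy => by rw [hrec y x hy.symm]; ring]
      linarith [hitting_time_defect hpisum hstat (hrec x)]
    simp only [mul_sub, sum_sub_distrib, mul_one, hpisum] at hsum
    have hcomm : ∑ y, pi y * ∑ z, P x z * h y z = ∑ z, P x z * ∑ y, pi y * h y z := by
      simp only [mul_sum]
      rw [sum_comm]
      simp only [mul_left_comm]
    linarith
end

section
/- Consider a reversible chain setup with transition matrix P, stationary vector π and Laplacian L. For each state y, let h_y ∈ ℝ^n satisfy h_y(y) = 0 and h_y(t) = 1 + Σ_z P(t,z)·h_y(z) for all t ≠ y, and set the commute time c(x,y) := h_y(x) + h_x(y). Then for every state x, Σ_y π(y)·h_y(x) = (1/2)·Σ_{x',y'} π(x')·π(y')·c(x',y'), where the double sum is over all ordered pairs of states. -/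
open Matrix Finset

/-- A detailed-balance measure is stationary. -/
lemma sum_mul_eq_of_detailed_balance {ι : Type*} [Fintype ι] {P : Matrix ι ι ℝ} {w : ι → ℝ}
    (hrow : ∀ x, ∑ y, P x y = 1) (hrev : ∀ x y, w x * P x y = w y * P y x) (f : ι → ℝ) :
    ∑ x, w x * ∑ y, P x y * f y = ∑ y, w y * f y := by
  simp_rw [Finset.mul_sum, ← mul_assoc]
  rw [Finset.sum_comm]
  refine Finset.sum_congr rfl fun y _ => ?_
  simp_rw [fun x => hrev x y]
  rw [← Finset.sum_mul, ← Finset.mul_sum, hrow, mul_one]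

/-- A harmonic function of a reversible chain takes equal values at the ends of every
transition of positive probability. -/
lemma eq_of_harmonic_of_pos {ι : Type*} [Fintype ι] {P : Matrix ι ι ℝ} {w : ι → ℝ}
    (hP : ∀ x y, 0 ≤ P x y) (hrow : ∀ x, ∑ y, P x y = 1) (hw : ∀ x, 0 < w x)
    (hrev : ∀ x y, w x * P x y = w y * P y x) {f : ι → ℝ}
    (hf : ∀ x, f x = ∑ y, P x y * f y) {x y : ι} (hxy : 0 < P x y) : f x = f y := by
  have hnn : ∀ a b, 0 ≤ w a * (P a b * (f a - f b) ^ 2) := fun a b =>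
    mul_nonneg (hw a).le (mul_nonneg (hP a b) (sq_nonneg _))
  have hinner : ∀ a, ∑ b, w a * (P a b * (f a - f b) ^ 2)
      = w a * ∑ b, P a b * f b ^ 2 - w a * f a ^ 2 := by
    intro a
    have hexp : ∀ b, P a b * (f a - f b) ^ 2
        = f a ^ 2 * P a b - 2 * f a * (P a b * f b) + P a b * f b ^ 2 := fun b => by ring
    rw [← Finset.mul_sum]
    simp_rw [hexp]
    rw [Finset.sum_add_distrib, Finset.sum_sub_distrib, ← Finset.mul_sum, ← Finset.mul_sum,
      hrow, ← hf]
    ring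
  have hzero : ∑ a, ∑ b, w a * (P a b * (f a - f b) ^ 2) = 0 := by
    simp_rw [hinner]
    rw [Finset.sum_sub_distrib, sum_mul_eq_of_detailed_balance hrow hrev (fun b => f b ^ 2),
      sub_self]
  have hx := (Finset.sum_eq_zero_iff_of_nonneg
    (fun a _ => Finset.sum_nonneg fun b _ => hnn a b)).1 hzero x (Finset.mem_univ x)
  have hy := (Finset.sum_eq_zero_iff_of_nonneg (fun b _ => hnn x b)).1 hx y (Finset.mem_univ y)
  have hsq : (f x - f y) ^ 2 = 0 := by simpa [(hw x).ne', hxy.ne'] using hy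
  exact sub_eq_zero.1 (pow_eq_zero_iff two_ne_zero |>.1 hsq)

/-- A harmonic function of an irreducible reversible chain is constant. -/
lemma eq_of_harmonic {ι : Type*} [Fintype ι] {P : Matrix ι ι ℝ} {w : ι → ℝ}
    (hP : ∀ x y, 0 ≤ P x y) (hrow : ∀ x, ∑ y, P x y = 1) (hw : ∀ x, 0 < w x)
    (hrev : ∀ x y, w x * P x y = w y * P y x)
    (hconn : (SimpleGraph.fromRel (fun x y : ι => 0 < P x y)).Connected) {f : ι → ℝ}
    (hf : ∀ x, f x = ∑ y, P x y * f y) (x y : ι) : f x = f y := by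
  obtain ⟨p⟩ := hconn.preconnected x y
  induction p with
  | nil => rfl
  | cons hadj _ ih =>
    refine Eq.trans ?_ ih
    rcases ((SimpleGraph.fromRel_adj _ _ _).1 hadj).2 with hpos | hpos
    · exact eq_of_harmonic_of_pos hP hrow hw hrev hf hpos
    · exact (eq_of_harmonic_of_pos hP hrow hw hrev hf hpos).symm

/-- The hitting-time recursion extended to the target state, where the defect is the
expected return time `1 / w y`. -/
lemma mul_hitting_time_defect {ι : Type*} [Fintype ι] [DecidableEq ι] {P : Matrix ι ι ℝ}
    {w : ι → ℝ} (hrow : ∀ x, ∑ y, P x y = 1) (hsum : ∑ x, w x = 1)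
    (hrev : ∀ x y, w x * P x y = w y * P y x) {y : ι} {g : ι → ℝ}
    (hg : ∀ t, t ≠ y → g t = 1 + ∑ z, P t z * g z) (t : ι) :
    w y * (1 + ∑ z, P t z * g z - g t) = if t = y then 1 else 0 := by
  split_ifs with hty
  · subst hty
    have htotal : ∑ s, w s * (1 + ∑ z, P s z * g z - g s) = 1 := by
      simp_rw [mul_sub, mul_add, mul_one]
      rw [Finset.sum_sub_distrib, Finset.sum_add_distrib,
        sum_mul_eq_of_detailed_balance hrow hrev, hsum, add_sub_cancel_right]
    rw [Finset.sum_eq_single t] at htotal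
    · exact htotal
    · intro s _ hs
      rw [← hg s hs, sub_self, mul_zero]
    · simp
  · rw [← hg t hty, sub_self, mul_zero]

/-- Equation (2): Kemeny's constant expressed in terms of commute times,
`Σ_y π(y) h_y(x) = (1/2) Σ_{x',y'} π(x') π(y') c(x',y')`. -/
theorem kemeny_constant_commute_times (n : ℕ) (hn : 2 ≤ n)
    (P L : Matrix (Fin n) (Fin n) ℝ) (pi : Fin n → ℝ)
    -- reversible chain setup
    (hP0 : ∀ x y, 0 ≤ P x y)
    (hPdiag : ∀ x, P x x = 0)
    (hProw : ∀ x, ∑ y, P x y = 1)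
    (hpipos : ∀ x, 0 < pi x)
    (hpisum : ∑ x, pi x = 1)
    (hrev : ∀ x y, pi x * P x y = pi y * P y x)
    (hconn : (SimpleGraph.fromRel (fun x y : Fin n => 0 < P x y)).Connected)
    -- the Laplacian matrix
    (hLdiag : ∀ x, L x x = pi x)
    (hLoff : ∀ x y, x ≠ y → L x y = -(pi x * P x y))
    -- hitting times to each state y
    (h : Fin n → Fin n → ℝ)
    (hdiag : ∀ y, h y y = 0)
    (hrec : ∀ y t, t ≠ y → h y t = 1 + ∑ z, P t z * h y z)
    -- commute times
    (c : Fin n → Fin n → ℝ)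
    (hc : ∀ x y, c x y = h y x + h x y) :
    ∀ x : Fin n,
      ∑ y, pi y * h y x = (1/2) * ∑ x' : Fin n, ∑ y' : Fin n, pi x' * pi y' * c x' y' := by
  have hharm : ∀ t, ∑ y, pi y * h y t = ∑ z, P t z * ∑ y, pi y * h y z := by
    intro t
    have hdefect : ∑ y, pi y * (1 + ∑ z, P t z * h y z - h y t) = 1 := by
      simp_rw [fun y => mul_hitting_time_defect hProw hpisum hrev (hrec y) t]
      simp
    have hswap : ∑ z, P t z * ∑ y, pi y * h y z = ∑ y, pi y * ∑ z, P t z * h y z := by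
      simp_rw [Finset.mul_sum]
      rw [Finset.sum_comm]
      exact Finset.sum_congr rfl fun y _ => Finset.sum_congr rfl fun z _ => by ring
    simp_rw [mul_sub, mul_add, mul_one] at hdefect
    rw [Finset.sum_sub_distrib, Finset.sum_add_distrib, hpisum] at hdefect
    linarith
  intro x
  have hconst := fun t => eq_of_harmonic hP0 hProw hpipos hrev hconn hharm t x
  have hmean : ∑ x', ∑ y', pi x' * pi y' * h y' x' = ∑ y, pi y * h y x := by
    simp_rw [mul_assoc, ← Finset.mul_sum, hconst]
    rw [← Finset.sum_mul, hpisum, one_mul]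
  have hmean' : ∑ x', ∑ y', pi x' * pi y' * h x' y' = ∑ y, pi y * h y x := by
    rw [← hmean, Finset.sum_comm]
    exact Finset.sum_congr rfl fun y _ => Finset.sum_congr rfl fun z _ => by ring
  simp_rw [hc, mul_add, Finset.sum_add_distrib]
  rw [hmean, hmean']
  ring
end

section
/- Let v_1, …, v_n be points of the Euclidean space ℝ^{n−1} forming an affine basis, and let a, b ∈ ℝ^{n−1} be any two points with barycentric coordinates â, b̂ ∈ ℝ^n. Then ‖a − b‖² = −(1/2)·Σ_{x,y} ‖v_x − v_y‖²·(â(x) − b̂(x))·(â(y) − b̂(y)), where the sum is over all ordered pairs of indices x, y. -/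
open Finset

/-- Lemma 4.2 (Fiedler, Cor. 1.2.10): the squared distance between two points of a
simplex in terms of squared edge lengths and barycentric coordinates. -/
theorem squared_distance_barycentric (n : ℕ) (hn : 2 ≤ n)
    (v : Fin n → EuclideanSpace ℝ (Fin (n-1)))
    -- v forms an affine basis
    (hv : AffineIndependent ℝ v)
    (hspan : affineSpan ℝ (Set.range v) = ⊤)
    (a b : EuclideanSpace ℝ (Fin (n-1)))
    (ah bh : Fin n → ℝ)
    -- barycentric coordinates of a and b
    (hasum : ∑ x, ah x = 1) (hbsum : ∑ x, bh x = 1)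
    (ha : ∑ x, ah x • v x = a) (hb : ∑ x, bh x • v x = b) :
    ‖a - b‖^2 =
      -(1/2) * ∑ x : Fin n, ∑ y : Fin n,
        ‖v x - v y‖^2 * (ah x - bh x) * (ah y - bh y) := by
  have hsum : ∑ x, (ah x - bh x) = 0 := by
    rw [Finset.sum_sub_distrib, hasum, hbsum, sub_self]
  have hab : a - b = ∑ x, (ah x - bh x) • v x := by
    simp only [sub_smul, Finset.sum_sub_distrib, ha, hb]
  rw [hab, ← real_inner_self_eq_norm_sq, inner_sum_smul_sum_smul_of_sum_eq_zero _ hsum _ hsum,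
    neg_div, neg_mul, div_eq_inv_mul, one_div]
  congr 2
  refine Finset.sum_congr rfl fun x _ => Finset.sum_congr rfl fun y _ => ?_
  ring
end

section
/- Let v_1, …, v_n be points of the Euclidean space ℝ^{n−1} forming an affine basis, let w ∈ ℝ^n with Σ_x w(x) = 1, let p = Σ_x w(x)·v_x, and let R ≥ 0. Then the following are equivalent: (i) ‖p − v_x‖ = R for every index x (i.e., p is the circumcenter of the simplex with circumradius R); (ii) Σ_y ‖v_x − v_y‖²·w(y) = 2R² for every index x. -/
open Finset

/-- The weighted sum of squared distances from `a` to points `v y`, split at their barycenter. -/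
theorem sum_norm_sub_sq_mul_eq {ι E : Type*} [Fintype ι] [NormedAddCommGroup E]
    [InnerProductSpace ℝ E] (v : ι → E) (w : ι → ℝ) (hw : ∑ y, w y = 1) (a : E) :
    ∑ y, ‖a - v y‖ ^ 2 * w y =
      ‖∑ z, w z • v z - a‖ ^ 2 + ∑ y, w y * ‖∑ z, w z • v z - v y‖ ^ 2 := by
  set p := ∑ z, w z • v z with hp
  have hzero : ∑ y, w y • (p - v y) = 0 := by
    simp only [smul_sub, sum_sub_distrib, ← sum_smul, hw, one_smul, ← hp, sub_self]
  have hcross : ∑ y, w y * inner ℝ (p - a) (p - v y) = 0 := by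
    simp only [← real_inner_smul_right, ← inner_sum, hzero, inner_zero_right]
  have hterm : ∀ y, ‖a - v y‖ ^ 2 * w y = w y * ‖p - a‖ ^ 2 + w y * ‖p - v y‖ ^ 2
      - 2 * (w y * inner ℝ (p - a) (p - v y)) := fun y => by
    have h := norm_sub_sq_real (p - a) (p - v y)
    rw [sub_sub_sub_cancel_left, norm_sub_rev] at h
    rw [h]
    ring
  simp only [hterm, sum_sub_distrib, sum_add_distrib, ← sum_mul, ← mul_sum, hw, hcross]
  ring

/-- Proposition 4.1 (circumcenter part; Fiedler, Cor. 1.4.13): a point `p` with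
barycentric coordinates `w` is the circumcenter at distance `R` from all vertices
if and only if `Σ_y ‖v_x − v_y‖² w(y) = 2R²` for every `x`. -/
theorem circumcenter_characterization (n : ℕ) (hn : 2 ≤ n)
    (v : Fin n → EuclideanSpace ℝ (Fin (n-1)))
    -- v forms an affine basis
    (hv : AffineIndependent ℝ v)
    (hspan : affineSpan ℝ (Set.range v) = ⊤)
    (w : Fin n → ℝ) (hwsum : ∑ x, w x = 1)
    (p : EuclideanSpace ℝ (Fin (n-1))) (hp : p = ∑ x, w x • v x)
    (R : ℝ) (hR : 0 ≤ R) :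
    (∀ x, ‖p - v x‖ = R) ↔ (∀ x, ∑ y, ‖v x - v y‖^2 * w y = 2 * R^2) := by
  subst hp
  simp only [sum_norm_sub_sq_mul_eq v w hwsum]
  set p := ∑ x, w x • v x
  constructor
  · intro h x
    simp only [h, ← sum_mul, hwsum]
    ring
  · intro h x
    have hS : ∑ y, w y * ‖p - v y‖ ^ 2 = R ^ 2 := by
      have hsum : ∑ x, w x * (‖p - v x‖ ^ 2 + ∑ y, w y * ‖p - v y‖ ^ 2) = 2 * R ^ 2 := by
        simp only [h, ← sum_mul, hwsum, one_mul]
      simp only [mul_add, sum_add_distrib, ← sum_mul, hwsum] at hsum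
      linarith
    have hx := h x
    rw [← sq_eq_sq₀ (norm_nonneg _) hR]
    linarith
end

section
/- Let L be a symmetric positive semidefinite real n×n matrix whose kernel is exactly the span of the all-ones vector 1, let L† be its Moore–Penrose pseudoinverse, and let V be an (n−1)×n real matrix with VᵀV = L† and V·1 = 0, with columns v_1, …, v_n ∈ ℝ^{n−1} (which are then affinely independent). Write π(x) := L(x,x) for the diagonal entries of L. Then for every point p ∈ ℝ^{n−1} with barycentric coordinates p̂ and every index x, the Euclidean distance from p to the affine span of the points {v_y : y ≠ x} (the facet of the simplex opposite vertex v_x) equals |p̂(x)| / √(π(x)). -/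
open Matrix Finset

open scoped InnerProductSpace in
/-- If `w` is a gradient of the barycentric coordinate `x`, i.e. `⟪w, ∑ a c • v c⟫ = a x` for all
weights `a` summing to zero, and `w = ∑ ℓ c • v c` with `∑ ℓ c = 0`, then the distance of a point
to the facet opposite `v x` is its barycentric coordinate at `x` divided by `‖w‖ = √(ℓ x)`. -/
theorem infDist_affineSpan_image_ne {ι E : Type*} [Fintype ι] [DecidableEq ι]
    [NormedAddCommGroup E] [InnerProductSpace ℝ E] [Nontrivial ι] (v : ι → E) (ℓ ph : ι → ℝ)
    (x : ι) (hℓ : ∑ c, ℓ c = 0)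
    (hw : ∀ a : ι → ℝ, ∑ c, a c = 0 → ⟪∑ c, ℓ c • v c, ∑ c, a c • v c⟫_ℝ = a x)
    (hph : ∑ c, ph c = 1) :
    Metric.infDist (∑ c, ph c • v c) (affineSpan ℝ (v '' {y | y ≠ x}) : Set E) =
      |ph x| / √(ℓ x) := by
  obtain ⟨z, hz⟩ := exists_ne x
  set w := ∑ c, ℓ c • v c with hwdef
  set p := ∑ c, ph c • v c with hpdef
  have hne : w ≠ 0 := by
    intro h0
    have := hw (Pi.single x 1 - Pi.single z 1) (by simp)
    simp [h0, hz.symm] at this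
  have hwsq : ‖w‖ ^ 2 = ℓ x := by rw [← real_inner_self_eq_norm_sq, hwdef, hw ℓ hℓ]
  have hpos : 0 < ‖w‖ := norm_pos_iff.mpr hne
  have hsqrt : √(ℓ x) = ‖w‖ := by rw [← hwsq, Real.sqrt_sq hpos.le]
  have hℓx : ℓ x ≠ 0 := by rw [← hwsq]; positivity
  have hmem : p - (ph x / ℓ x) • w ∈ affineSpan ℝ (v '' {y | y ≠ x}) := by
    set b : ι → ℝ := fun c => ph c - ph x / ℓ x * ℓ c with hb
    have hb1 : ∑ c, b c = 1 := by
      simp [hb, Finset.sum_sub_distrib, ← Finset.mul_sum, hℓ, hph]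
    have hbx : b x = 0 := by simp [hb, hℓx]
    have hsum : p - (ph x / ℓ x) • w = ∑ c, b c • v c := by
      simp [hb, hpdef, hwdef, sub_smul, mul_smul, Finset.smul_sum, Finset.sum_sub_distrib]
    rw [hsum, ← Finset.univ.affineCombination_eq_linear_combination v b hb1]
    refine affineCombination_mem_affineSpan_image hb1 (fun i _ hi => ?_) v
    obtain rfl : i = x := by simpa using hi
    exact hbx
  have hfacet : ∀ q ∈ affineSpan ℝ (v '' {y | y ≠ x}), ⟪w, p - q⟫_ℝ = ph x := by
    intro q hq
    refine affineSpan_induction (p := fun q => ⟪w, p - q⟫_ℝ = ph x) hq (fun q hq => ?_)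
      fun c q₁ q₂ q₃ h₁ h₂ h₃ => ?_
    · obtain ⟨y, hy, rfl⟩ := hq
      have := hw (ph - Pi.single y 1) (by simp [Finset.sum_sub_distrib, hph])
      simpa [sub_smul, Finset.sum_sub_distrib, Pi.single_apply, ← hpdef, Ne.symm hy] using this
    · simp only [vsub_eq_sub, vadd_eq_add, inner_sub_right, inner_add_right,
        inner_smul_right] at *
      linear_combination c * (h₁ - h₂) + h₃
  rw [hsqrt]
  apply le_antisymm
  · refine (Metric.infDist_le_dist_of_mem hmem).trans_eq ?_
    rw [dist_eq_norm, sub_sub_cancel, norm_smul, Real.norm_eq_abs, abs_div, ← hwsq,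
      abs_of_pos (pow_pos hpos 2)]
    field_simp
  · refine (Metric.le_infDist ⟨_, hmem⟩).mpr fun q hq => ?_
    rw [div_le_iff₀ hpos, ← hfacet q hq, dist_eq_norm, mul_comm]
    exact abs_real_inner_le_norm _ _

/-- The pseudoinverse of a symmetric matrix whose kernel is spanned by the all-ones vector inverts
it on vectors with zero sum. -/
theorem Matrix.mul_pinv_mulVec_of_sum_eq_zero {ι : Type*} [Fintype ι] [Nonempty ι]
    {L Ld : Matrix ι ι ℝ} (hsym : L.IsSymm) (hdsym : Ld.IsSymm)
    (hker : ∀ f : ι → ℝ, L *ᵥ f = 0 ↔ ∃ c : ℝ, ∀ i, f i = c)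
    (hp1 : L * Ld * L = L) (hp3 : (L * Ld)ᵀ = L * Ld)
    {a : ι → ℝ} (ha : ∑ c, a c = 0) : (L * Ld) *ᵥ a = a := by
  have hcomm : Ld * L = L * Ld := by rw [← hp3, transpose_mul, hsym.eq, hdsym.eq]
  obtain ⟨c, hc⟩ := (hker ((L * Ld) *ᵥ a - a)).mp (by
    rw [mulVec_sub, mulVec_mulVec, ← hcomm, ← Matrix.mul_assoc, hp1, sub_self])
  have h1 : L *ᵥ 1 = 0 := (hker 1).mpr ⟨1, fun _ => rfl⟩
  have hsum : ∑ i, ((L * Ld) *ᵥ a) i = 0 := by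
    rw [← one_dotProduct, dotProduct_mulVec, ← mulVec_transpose, hp3, ← hcomm, ← mulVec_mulVec, h1,
      mulVec_zero, zero_dotProduct]
  have hc0 : c = 0 := by
    have : ∑ i, ((L * Ld) *ᵥ a - a) i = 0 := by simp [Finset.sum_sub_distrib, hsum, ha]
    simpa [hc] using this
  ext i
  simpa [hc0, sub_eq_zero] using hc i

/-- Lemma 4.1 (Fiedler, Cor. 1.4.14): the distance from a point `p` with barycentric
coordinates `p̂` to the facet of the simplex opposite vertex `v_x` equals
`|p̂(x)| / √(π(x))`, where `π(x) = L(x,x)`. -/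
theorem distance_to_facet (n : ℕ) (hn : 2 ≤ n)
    (L Ld : Matrix (Fin n) (Fin n) ℝ)
    (hsym : L.IsSymm)
    (hpsd : L.PosSemidef)
    (hker : ∀ f : Fin n → ℝ, L.mulVec f = 0 ↔ ∃ c : ℝ, ∀ i, f i = c)
    -- Ld is the Moore–Penrose pseudoinverse of L (the four Penrose conditions)
    (hp1 : L * Ld * L = L) (hp2 : Ld * L * Ld = Ld)
    (hp3 : (L * Ld)ᵀ = L * Ld) (hp4 : (Ld * L)ᵀ = Ld * L)
    -- the matrix V with VᵀV = L† and V·1 = 0, whose columns are the simplex vertices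
    (V : Matrix (Fin (n-1)) (Fin n) ℝ)
    (hV : Vᵀ * V = Ld)
    (hV1 : V.mulVec (fun _ => 1) = 0)
    (v : Fin n → EuclideanSpace ℝ (Fin (n-1)))
    (hv : ∀ c j, v c j = V j c)
    -- a point p with barycentric coordinates ph
    (p : EuclideanSpace ℝ (Fin (n-1))) (ph : Fin n → ℝ)
    (hpsum : ∑ x, ph x = 1) (hp : ∑ x, ph x • v x = p)
    (x : Fin n) :
    Metric.infDist p
        ((affineSpan ℝ (v '' {y | y ≠ x}) : AffineSubspace ℝ (EuclideanSpace ℝ (Fin (n-1)))) :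
          Set (EuclideanSpace ℝ (Fin (n-1)))) =
      |ph x| / Real.sqrt (L x x) := by
  have : Nontrivial (Fin n) := Fin.nontrivial_iff_two_le.mpr hn
  have : Nonempty (Fin n) := ⟨x⟩
  have hdsym : Ld.IsSymm := by rw [← hV]; simp [IsSymm, transpose_mul]
  have h1 : L *ᵥ 1 = 0 := (hker 1).mpr ⟨1, fun _ => rfl⟩
  have hcoord (b : Fin n → ℝ) : (∑ c, b c • v c).ofLp = V *ᵥ b := by
    ext j
    simp [hv, mulVec, dotProduct, mul_comm]
  rw [← hp]
  refine infDist_affineSpan_image_ne v (L x) ph x ?_ (fun a ha => ?_) hpsum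
  · simpa [mulVec, dotProduct] using congrFun h1 x
  · rw [EuclideanSpace.inner_eq_star_dotProduct, hcoord, hcoord, star_trivial, dotProduct_comm,
      dotProduct_mulVec, ← mulVec_transpose, mulVec_mulVec, hV, ← hdsym.eq, mulVec_transpose,
      ← dotProduct_mulVec]
    change (L *ᵥ (Ld *ᵥ a)) x = a x
    rw [mulVec_mulVec, mul_pinv_mulVec_of_sum_eq_zero hsym hdsym hker hp1 hp3 ha]
end

section
/- Let L be a symmetric positive semidefinite real n×n matrix whose kernel is exactly the span of the all-ones vector 1, with diagonal entries π(x) := L(x,x) satisfying Σ_x π(x) = 1, let L† be its Moore–Penrose pseudoinverse, and let V be an (n−1)×n real matrix with VᵀV = L† and V·1 = 0, with columns v_1, …, v_n ∈ ℝ^{n−1}. For p ∈ ℝ^{n−1}, let D(p) := Σ_x d(p, F_x)², where F_x is the affine span of {v_y : y ≠ x} and d denotes Euclidean distance to an affine subspace. Then D(p) ≥ 1 for every p ∈ ℝ^{n−1}, with equality if and only if p = Σ_x π(x)·v_x; that is, the unique minimizer of the total squared distance to the facets of the simplex is the point with barycentric coordinates π (the Lemoine point), and the minimum value is 1. -/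
open Matrix Finset

open scoped RealInnerProductSpace

section Simplex

variable {ι E : Type*} [NormedAddCommGroup E] [InnerProductSpace ℝ E]

/-- If an affine subspace lies in the hyperplane `⟪w, ·⟫ = c` and contains the point `p - t • w`,
then that point is the foot of the perpendicular from `p`. -/
theorem infDist_eq_of_sub_smul_mem {S : AffineSubspace ℝ E} {w p : E} {c t : ℝ}
    (hS : ∀ r ∈ S, ⟪w, r⟫ = c) (hfoot : p - t • w ∈ S) :
    Metric.infDist p (S : Set E) = |t| * ‖w‖ := by
  apply le_antisymm
  · refine (Metric.infDist_le_dist_of_mem hfoot).trans_eq ?_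
    rw [dist_eq_norm, sub_sub_cancel, norm_smul, Real.norm_eq_abs]
  · rw [Metric.le_infDist ⟨_, hfoot⟩]
    intro r hr
    rcases (norm_nonneg w).eq_or_lt with hw | hw
    · simp [← hw]
    have hinner : ⟪w, p - r⟫ = t * ‖w‖ ^ 2 := by
      have h := hS _ hfoot
      rw [inner_sub_right, real_inner_smul_right, real_inner_self_eq_norm_sq] at h
      rw [inner_sub_right, hS r hr]
      linarith
    have hcs := abs_real_inner_le_norm w (p - r)
    rw [hinner, abs_mul, abs_of_nonneg (sq_nonneg ‖w‖)] at hcs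
    rw [dist_eq_norm]
    exact le_of_mul_le_mul_left (by linarith) hw

variable [DecidableEq ι] {v w : ι → E} {a : ℝ}

theorem inner_eq_of_mem_affineSpan_facet
    (hwv : ∀ x y, ⟪w x, v y⟫ = (if x = y then 1 else 0) - a) {x : ι} {r : E}
    (hr : r ∈ affineSpan ℝ (v '' {y | y ≠ x})) : ⟪w x, r⟫ = -a := by
  refine affineSpan_induction hr ?_ fun c u₁ u₂ u₃ h₁ h₂ h₃ => ?_
  · rintro _ ⟨y, hy, rfl⟩
    simp [hwv, Ne.symm hy]
  · simp [inner_add_right, real_inner_smul_right, inner_sub_right, h₁, h₂, h₃]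

variable [Fintype ι]

theorem inner_sum_smul_of_dual (hwv : ∀ x y, ⟪w x, v y⟫ = (if x = y then 1 else 0) - a)
    (b : ι → ℝ) (x : ι) : ⟪w x, ∑ y, b y • v y⟫ = b x - a * ∑ y, b y := by
  simp [inner_sum, real_inner_smul_right, hwv, mul_sub, sum_sub_distrib, mul_sum, mul_comm]

theorem affineIndependent_of_dual
    (hwv : ∀ x y, ⟪w x, v y⟫ = (if x = y then 1 else 0) - a) : AffineIndependent ℝ v := by
  rw [affineIndependent_iff_of_fintype]
  intro b hb hbv i
  rw [univ.weightedVSub_eq_linear_combination hb] at hbv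
  have h := inner_sum_smul_of_dual hwv b i
  simpa [hbv, hb] using h.symm

theorem sum_smul_mem_affineSpan_facet (v : ι → E) {b : ι → ℝ} {x : ι} (hb : ∑ y, b y = 1)
    (hbx : b x = 0) : ∑ y, b y • v y ∈ affineSpan ℝ (v '' {y | y ≠ x}) := by
  rw [← affineCombination_eq_linear_combination _ _ _ hb]
  exact affineCombination_mem_affineSpan_image hb
    (fun i _ hi => by simp_all) v

/-- Squared distance to a facet of a simplex in terms of barycentric coordinates `b`. -/
theorem infDist_facet_sq (hwv : ∀ x y, ⟪w x, v y⟫ = (if x = y then 1 else 0) - a)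
    {L : Matrix ι ι ℝ} (hw : ∀ x, w x = ∑ y, L x y • v y) (hL : ∀ x, ∑ y, L x y = 0)
    {x : ι} (hnorm : ⟪w x, w x⟫ = L x x) (hpos : 0 < L x x) {b : ι → ℝ} (hb : ∑ y, b y = 1) :
    Metric.infDist (∑ y, b y • v y) (affineSpan ℝ (v '' {y | y ≠ x}) : Set E) ^ 2 =
      b x ^ 2 / L x x := by
  have hfoot : ∑ y, b y • v y - (b x / L x x) • w x ∈ affineSpan ℝ (v '' {y | y ≠ x}) := by
    have hrw : ∑ y, b y • v y - (b x / L x x) • w x =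
        ∑ y, (b y - b x / L x x * L x y) • v y := by
      simp only [hw, smul_sum, sub_smul, sum_sub_distrib, mul_smul]
    rw [hrw]
    apply sum_smul_mem_affineSpan_facet
    · rw [sum_sub_distrib, ← mul_sum, hL, hb]
      ring
    · field_simp
      ring
  rw [infDist_eq_of_sub_smul_mem (fun r hr => inner_eq_of_mem_affineSpan_facet hwv hr) hfoot,
    mul_pow, sq_abs, ← real_inner_self_eq_norm_sq, hnorm]
  field_simp

end Simplex

theorem sum_sq_div_eq_one_add {ι : Type*} [Fintype ι] {b c : ι → ℝ} (hc : ∀ x, 0 < c x)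
    (hb : ∑ x, b x = 1) (hcs : ∑ x, c x = 1) :
    ∑ x, b x ^ 2 / c x = 1 + ∑ x, (b x - c x) ^ 2 / c x := by
  have h : ∀ x, b x ^ 2 / c x = (b x - c x) ^ 2 / c x + 2 * b x - c x := by
    intro x
    have := (hc x).ne'
    field_simp
    ring
  simp only [h, sum_sub_distrib, sum_add_distrib, ← mul_sum, hb, hcs]
  ring

/-- If the kernel of a symmetric matrix `L` consists of the constant vectors, then a symmetric
`Q` with `Q * L = L` and `Q *ᵥ 1 = 0` is the projection `1 - J / n`. -/
theorem eq_one_sub_inv_card {ι : Type*} [Fintype ι] [DecidableEq ι] [Nonempty ι]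
    {L Q : Matrix ι ι ℝ} (hL : L.IsSymm) (hQ : Qᵀ = Q) (hQL : Q * L = L)
    (hker : ∀ f : ι → ℝ, L *ᵥ f = 0 → ∃ c : ℝ, ∀ i, f i = c) (hQ1 : ∀ x, ∑ y, Q x y = 0)
    (x y : ι) : Q x y = (if x = y then 1 else 0) - (Fintype.card ι : ℝ)⁻¹ := by
  have hLR : L * (1 - Q) = 0 := by
    have h := congrArg transpose hQL
    rw [transpose_mul, hL.eq, hQ] at h
    rw [mul_sub, mul_one, h, sub_self]
  have hcol : ∀ i j k, (1 - Q) i k = (1 - Q) j k := by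
    intro i j k
    obtain ⟨c, hc⟩ := hker (fun i => (1 - Q) i k) (by
      ext i
      exact congrFun (congrFun hLR i) k)
    exact (hc i).trans (hc j).symm
  have hsymm : ∀ i j, (1 - Q) i j = (1 - Q) j i := fun i j => by
    rw [← transpose_apply (1 - Q), transpose_sub, transpose_one, hQ]
  have hconst : ∀ z, (1 - Q) x z = (1 - Q) x y := fun z => by
    rw [hsymm x z, hcol z y x, hsymm y x]
  have hsum : ∑ z, (1 - Q) x z = 1 := by
    simp [Matrix.one_apply, hQ1]
  simp only [hconst, sum_const, card_univ, nsmul_eq_mul] at hsum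
  have hval : (1 - Q) x y = (Fintype.card ι : ℝ)⁻¹ := eq_inv_of_mul_eq_one_right hsum
  rw [← hval, Matrix.sub_apply, Matrix.one_apply]
  ring

/-- Proposition 4.1 (Lemoine point part; Fiedler, Thm. 2.2.3): the total squared
distance from a point to the facets of the simplex is at least `1`, with equality
exactly at the point with barycentric coordinates `π(x) = L(x,x)` (the Lemoine point). -/
theorem lemoine_point_minimizes (n : ℕ) (hn : 2 ≤ n)
    (L Ld : Matrix (Fin n) (Fin n) ℝ)
    (hsym : L.IsSymm)
    (hpsd : L.PosSemidef)
    (hker : ∀ f : Fin n → ℝ, L.mulVec f = 0 ↔ ∃ c : ℝ, ∀ i, f i = c)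
    (hdiagsum : ∑ x, L x x = 1)
    -- Ld is the Moore–Penrose pseudoinverse of L (the four Penrose conditions)
    (hp1 : L * Ld * L = L) (hp2 : Ld * L * Ld = Ld)
    (hp3 : (L * Ld)ᵀ = L * Ld) (hp4 : (Ld * L)ᵀ = Ld * L)
    -- the matrix V with VᵀV = L† and V·1 = 0, whose columns are the simplex vertices
    (V : Matrix (Fin (n-1)) (Fin n) ℝ)
    (hV : Vᵀ * V = Ld)
    (hV1 : V.mulVec (fun _ => 1) = 0)
    (v : Fin n → EuclideanSpace ℝ (Fin (n-1)))
    (hv : ∀ c j, v c j = V j c)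
    -- total squared distance to the facets
    (D : EuclideanSpace ℝ (Fin (n-1)) → ℝ)
    (hD : ∀ p, D p = ∑ x : Fin n,
      (Metric.infDist p
        ((affineSpan ℝ (v '' {y | y ≠ x}) : AffineSubspace ℝ (EuclideanSpace ℝ (Fin (n-1)))) :
          Set (EuclideanSpace ℝ (Fin (n-1)))))^2) :
    ∀ p : EuclideanSpace ℝ (Fin (n-1)),
      1 ≤ D p ∧ (D p = 1 ↔ p = ∑ x, L x x • v x) := by
  have hn0 : NeZero n := ⟨by omega⟩
  have hgram : ∀ x y, ⟪v x, v y⟫ = Ld x y := by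
    intro x y
    simp [← hV, PiLp.inner_apply, Matrix.mul_apply, hv, mul_comm]
  have hLone : ∀ x, ∑ y, L x y = 0 := by
    intro x
    have h := congrFun ((hker fun _ => 1).2 ⟨1, fun _ => rfl⟩) x
    simpa [mulVec, dotProduct] using h
  have hLdone : ∀ x, ∑ y, Ld x y = 0 := by
    intro x
    have h : Ld *ᵥ (fun _ => 1) = 0 := by rw [← hV, ← mulVec_mulVec, hV1, mulVec_zero]
    simpa [mulVec, dotProduct] using congrFun h x
  have hQ := eq_one_sub_inv_card hsym hp3 hp1 (fun f => (hker f).1) (fun x => by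
    simp only [Matrix.mul_apply]
    rw [sum_comm]
    simp [← mul_sum, hLdone])
  let w : Fin n → EuclideanSpace ℝ (Fin (n - 1)) := fun x => ∑ y, L x y • v y
  have hwv' : ∀ x y, ⟪w x, v y⟫ = (L * Ld) x y := by
    intro x y
    simp [w, sum_inner, real_inner_smul_left, hgram, Matrix.mul_apply]
  have hwv : ∀ x y, ⟪w x, v y⟫ = (if x = y then 1 else 0) - (Fintype.card (Fin n) : ℝ)⁻¹ :=
    fun x y => (hwv' x y).trans (hQ x y)
  have hnorm : ∀ x, ⟪w x, w x⟫ = L x x := by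
    intro x
    have h := inner_sum_smul_of_dual hwv (L x) x
    rwa [hLone, mul_zero, sub_zero] at h
  have hpos : ∀ x, 0 < L x x := by
    intro x
    rw [← hnorm x, real_inner_self_pos]
    intro hw0
    have h := hwv x x
    have hn' : (2 : ℝ) ≤ n := by exact_mod_cast hn
    rw [hw0, inner_zero_left, if_pos rfl, Fintype.card_fin] at h
    field_simp at h
    linarith
  have hind := affineIndependent_of_dual hwv
  have htop : affineSpan ℝ (Set.range v) = ⊤ := by
    rw [hind.affineSpan_eq_top_iff_card_eq_finrank_add_one, finrank_euclideanSpace_fin,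
      Fintype.card_fin]
    omega
  intro p
  obtain ⟨b, hb, hbp⟩ := eq_affineCombination_of_mem_affineSpan_of_fintype
    (htop ▸ AffineSubspace.mem_top ℝ _ p : p ∈ affineSpan ℝ (Set.range v))
  rw [affineCombination_eq_linear_combination _ _ _ hb] at hbp
  have hDp : D p = 1 + ∑ x, (b x - L x x) ^ 2 / L x x := by
    rw [hD, ← sum_sq_div_eq_one_add hpos hb hdiagsum, hbp]
    exact sum_congr rfl fun x _ =>
      infDist_facet_sq hwv (fun _ => rfl) hLone (hnorm x) (hpos x) hb
  have hterm : ∀ x ∈ univ, 0 ≤ (b x - L x x) ^ 2 / L x x := fun x _ =>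
    div_nonneg (sq_nonneg _) (hpos x).le
  refine ⟨by rw [hDp]; linarith [sum_nonneg hterm], ?_⟩
  rw [hDp, add_eq_left, sum_eq_zero_iff_of_nonneg hterm]
  constructor
  · intro h
    rw [hbp]
    refine sum_congr rfl fun x hx => ?_
    have hx0 := h x hx
    rw [div_eq_zero_iff, or_iff_left (hpos x).ne', sq_eq_zero_iff, sub_eq_zero] at hx0
    rw [hx0]
  · intro h x _
    have h₁ := inner_sum_smul_of_dual hwv b x
    have h₂ := inner_sum_smul_of_dual hwv (fun y => L y y) x
    rw [← hbp, hb] at h₁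
    rw [← h, hdiagsum] at h₂
    have hx0 : b x = L x x := by linarith
    simp [hx0]
end

section
/- Let v_1, …, v_n be points of the Euclidean space ℝ^{n−1} forming an affine basis, let γ ∈ ℝ^{n−1} and R ≥ 0 satisfy ‖γ − v_x‖ = R for every index x (γ is the circumcenter and R the circumradius of the simplex), let π ∈ ℝ^n with Σ_x π(x) = 1, and let ℓ := Σ_x π(x)·v_x. Then (1/2)·Σ_{x,y} π(x)·π(y)·‖v_x − v_y‖² = R² − ‖γ − ℓ‖², where the sum is over all ordered pairs of indices x, y. -/
open Finset

/-- The squared norm of a linear combination, as a double sum of inner products. -/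
theorem norm_sum_smul_sq {ι E : Type*} [NormedAddCommGroup E] [InnerProductSpace ℝ E]
    (s : Finset ι) (w : ι → ℝ) (u : ι → E) :
    ‖∑ i ∈ s, w i • u i‖ ^ 2 = ∑ i ∈ s, ∑ j ∈ s, w i * w j * inner ℝ (u i) (u j) := by
  simp only [← real_inner_self_eq_norm_sq, sum_inner, inner_sum, real_inner_smul_left,
    real_inner_smul_right, mul_assoc]
  exact sum_congr rfl fun i _ => sum_congr rfl fun j _ => by rw [real_inner_comm]

/-- Weighted squared distances between points on a sphere, for weights of total mass one. -/
theorem half_sum_mul_norm_sub_sq_of_norm_sub_eq {ι E : Type*} [NormedAddCommGroup E]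
    [InnerProductSpace ℝ E] (s : Finset ι) (v : ι → E) (c : E) (R : ℝ)
    (hv : ∀ i ∈ s, ‖c - v i‖ = R) (w : ι → ℝ) (hw : ∑ i ∈ s, w i = 1) :
    (1 / 2) * ∑ i ∈ s, ∑ j ∈ s, w i * w j * ‖v i - v j‖ ^ 2
      = R ^ 2 - ‖c - ∑ i ∈ s, w i • v i‖ ^ 2 := by
  have hc : c - ∑ i ∈ s, w i • v i = ∑ i ∈ s, w i • (c - v i) := by
    simp only [smul_sub, sum_sub_distrib, ← sum_smul, hw, one_smul]
  have hR : R ^ 2 = ∑ i ∈ s, ∑ j ∈ s, w i * w j * R ^ 2 := by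
    simp only [← sum_mul, ← mul_sum, hw, one_mul, mul_one]
  rw [hc, norm_sum_smul_sq, hR, ← sum_sub_distrib, mul_sum]
  refine sum_congr rfl fun i hi => ?_
  rw [← sum_sub_distrib, mul_sum]
  refine sum_congr rfl fun j hj => ?_
  rw [← sub_sub_sub_cancel_left (v j) (v i) c, norm_sub_rev, norm_sub_sq_real, hv i hi, hv j hj]
  ring

/-- The geometric core of the Main Theorem (Theorem 1.1 = Theorem 4.2):
`(1/2) Σ_{x,y} π(x) π(y) ‖v_x − v_y‖² = R² − ‖γ − ℓ‖²`, where `γ` is the circumcenter,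
`R` the circumradius, and `ℓ = Σ π(x) v_x` the Lemoine point. -/
theorem kemeny_geometric_identity (n : ℕ) (hn : 2 ≤ n)
    (v : Fin n → EuclideanSpace ℝ (Fin (n-1)))
    -- v forms an affine basis
    (hv : AffineIndependent ℝ v)
    (hspan : affineSpan ℝ (Set.range v) = ⊤)
    -- circumcenter and circumradius
    (γ : EuclideanSpace ℝ (Fin (n-1))) (R : ℝ) (hR : 0 ≤ R)
    (hcirc : ∀ x, ‖γ - v x‖ = R)
    -- stationary weights and the Lemoine point
    (pi : Fin n → ℝ) (hpisum : ∑ x, pi x = 1)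
    (ℓ : EuclideanSpace ℝ (Fin (n-1))) (hl : ℓ = ∑ x, pi x • v x) :
    (1/2) * ∑ x : Fin n, ∑ y : Fin n, pi x * pi y * ‖v x - v y‖^2
      = R^2 - ‖γ - ℓ‖^2 := by
  subst hl
  exact half_sum_mul_norm_sub_sq_of_norm_sub_eq univ v γ R (fun x _ => hcirc x) pi hpisum
end
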